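/- arXiv:1405.4663 — 3 statements merged into one kernel-verified Lean document; each statement's English description precedes it below -/
import Mathlib

section
/- Let d ≥ 2, let B ⊆ ℂ_p be non-empty, let M ≥ 1 with B ⊆ D̄_M(0), let 0 < δ ≤ 1 with D̄_δ(z) ⊆ B for all z ∈ B, let λ > 1, and set μ := min{|l|^{1/(l−1)} : l ∈ {2,…,d}} · δ, where |l| is the p-adic absolute value of the integer l. Let f and g be polynomial maps of degree d over ℂ_p, each satisfying |f'(z)| ≥ λ, |g'(z)| ≥ λ for all z ∈ B and f⁻¹(B) ⊆ B, g⁻¹(B) ⊆ B, and suppose |f(z) − g(z)| ≤ μ for all z ∈ B. Then for every z ∈ f⁻¹(B) there exists exactly one w ∈ ℂ_p such that g(w) = f(z) and |w − z| ≤ μ/λ. -/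
open Polynomial

noncomputable section

/-- The projective line over `K`: `K` together with a point at infinity (`none`). -/
def P1 (K : Type*) := Option K

variable {K : Type*}

/-- Inclusion of `K` into the projective line. -/
def toP1 : K → P1 K := some

/-- The point at infinity of the projective line. -/
def P1.infty : P1 K := none

/-- The extension of a polynomial map to the projective line, sending `∞` to `∞`. -/
def polyMap [CommRing K] (f : K[X]) : P1 K → P1 K :=
  fun z => Option.map (fun w => f.eval w) z

/-- The chordal metric on the projective line over a normed field. -/
def chordal [NormedField K] (x y : P1 K) : ℝ :=
  match x, y with
  | some z, some w => ‖z - w‖ / (max ‖z‖ 1 * max ‖w‖ 1)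
  | some z, none => 1 / max ‖z‖ 1
  | none, some w => 1 / max ‖w‖ 1
  | none, none => 0

/-- A subset of the projective line is `ρ`-open if around each of its points it contains a
ball with respect to the chordal metric. -/
def IsRhoOpen [NormedField K] (U : Set (P1 K)) : Prop :=
  ∀ x ∈ U, ∃ ε > 0, ∀ y, chordal x y < ε → y ∈ U

/-- The topology on the projective line induced by the chordal metric. -/
instance P1.instTopologicalSpace (K : Type*) [NormedField K] : TopologicalSpace (P1 K) where
  IsOpen := IsRhoOpen
  isOpen_univ := fun _ _ => ⟨1, one_pos, fun _ _ => trivial⟩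
  isOpen_inter := fun U V hU hV x hx => by
    obtain ⟨ε₁, hε₁, h₁⟩ := hU x hx.1
    obtain ⟨ε₂, hε₂, h₂⟩ := hV x hx.2
    exact ⟨min ε₁ ε₂, lt_min hε₁ hε₂, fun y hy =>
      ⟨h₁ y (lt_of_lt_of_le hy (min_le_left _ _)), h₂ y (lt_of_lt_of_le hy (min_le_right _ _))⟩⟩
  isOpen_sUnion := fun S hS x hx => by
    obtain ⟨U, hUS, hxU⟩ := hx
    obtain ⟨ε, hε, h⟩ := hS U hUS x hxU
    exact ⟨ε, hε, fun y hy => ⟨U, hUS, h y hy⟩⟩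

/-- The Fatou set of a polynomial map: the largest `ρ`-open subset of the projective line on
which the family of iterates is equicontinuous with respect to the chordal metric. -/
def fatou [NormedField K] (f : K[X]) : Set (P1 K) :=
  {x | ∃ U : Set (P1 K), x ∈ U ∧ IsRhoOpen U ∧
    ∀ y ∈ U, ∀ ε > 0, ∃ δ > 0, ∀ z : P1 K, chordal y z < δ →
      ∀ n : ℕ, chordal ((polyMap f)^[n] y) ((polyMap f)^[n] z) < ε}

/-- The Julia set of a polynomial map: the complement of the Fatou set. -/
def julia [NormedField K] (f : K[X]) : Set (P1 K) :=
  (fatou f)ᶜ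

/-- The dynamics of `f` and `g` on their Julia sets are conjugate: there is a homeomorphism
`h : J(f) → J(g)` with `h ∘ f = g ∘ h` on `J(f)`. -/
def JuliaConjugate [NormedField K] (f g : K[X]) : Prop :=
  ∃ h : (julia f) ≃ₜ (julia g),
    ∀ (z : P1 K) (hz : z ∈ julia f), ∃ hfz : polyMap f z ∈ julia f,
      (h ⟨polyMap f z, hfz⟩ : P1 K) = polyMap g (h ⟨z, hz⟩)

/-- `min {|l|^{1/(l-1)} : 2 ≤ l ≤ d}` where `|l|` is the `p`-adic absolute value of `l`. -/
def muFactor (p : ℕ) [Fact (Nat.Prime p)] (d : ℕ) : ℝ :=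
  sInf {x : ℝ | ∃ l : ℕ, 2 ≤ l ∧ l ≤ d ∧ x = ‖(l : ℚ_[p])‖ ^ ((1 : ℝ) / ((l : ℝ) - 1))}

theorem norm_sub_le_max {S : Type*} [SeminormedAddCommGroup S] [IsUltrametricDist S] (x y : S) :
    ‖x - y‖ ≤ max ‖x‖ ‖y‖ := by
  simpa [sub_eq_add_neg] using IsUltrametricDist.norm_add_le_max x (-y)

/-- Over an algebraically closed ultrametric field, a polynomial without zeros in the closed disk
of radius `r` around `0` is strictly dominated there by its constant coefficient. -/
theorem norm_coeff_mul_pow_lt_of_eval_ne_zero {K : Type*} [NormedField K] [IsAlgClosed K]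
    [IsUltrametricDist K] {r : ℝ} (hr : 0 < r) (P : K[X])
    (hP : ∀ x : K, ‖x‖ ≤ r → P.eval x ≠ 0) {n : ℕ} (hn : n ≠ 0) :
    ‖P.coeff n‖ * r ^ n < ‖P.coeff 0‖ := by
  induction hk : P.natDegree generalizing P n with
  | zero =>
    have h0 : P.coeff 0 ≠ 0 := by
      rw [coeff_zero_eq_eval_zero]
      exact hP 0 (by simpa using hr.le)
    rw [coeff_eq_zero_of_natDegree_lt (by omega : P.natDegree < n)]
    simpa using h0
  | succ k ih =>
    have hdeg : P.degree ≠ 0 := degree_ne_of_natDegree_ne (n := 0) (by omega)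
    obtain ⟨s, hs⟩ := IsAlgClosed.exists_root P hdeg
    obtain ⟨Q, rfl⟩ := dvd_iff_isRoot.mpr hs
    have hsr : r < ‖s‖ := by
      by_contra! h
      exact hP s h hs
    have hQ : ∀ x : K, ‖x‖ ≤ r → Q.eval x ≠ 0 := fun x hx h0 => hP x hx (by simp [h0])
    have hQ0 : Q ≠ 0 := by
      rintro rfl
      simp at hk
    have hkQ : Q.natDegree = k := by
      rw [natDegree_mul (X_sub_C_ne_zero s) hQ0, natDegree_X_sub_C] at hk
      omega
    have hlt : ∀ {m : ℕ}, m ≠ 0 → ‖Q.coeff m‖ * r ^ m < ‖Q.coeff 0‖ := fun hm => ih Q hQ hm hkQ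
    have hle : ∀ m : ℕ, ‖Q.coeff m‖ * r ^ m ≤ ‖Q.coeff 0‖ := fun m => by
      rcases eq_or_ne m 0 with rfl | hm
      · simp
      · exact (hlt hm).le
    have hq0 : 0 < ‖Q.coeff 0‖ := by
      rw [norm_pos_iff, coeff_zero_eq_eval_zero]
      exact hQ 0 (by simpa using hr.le)
    obtain ⟨m, rfl⟩ := Nat.exists_eq_succ_of_ne_zero hn
    have e0 : ((X - C s) * Q).coeff 0 = -(s * Q.coeff 0) := by simp [mul_coeff_zero]
    have e1 : ((X - C s) * Q).coeff (m + 1) = Q.coeff m - s * Q.coeff (m + 1) := by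
      simp [sub_mul]
    rw [Nat.succ_eq_add_one, e0, e1, norm_neg, norm_mul]
    have h1 : ‖Q.coeff m‖ * r ^ (m + 1) < ‖s‖ * ‖Q.coeff 0‖ :=
      calc ‖Q.coeff m‖ * r ^ (m + 1) = r * (‖Q.coeff m‖ * r ^ m) := by ring
        _ ≤ r * ‖Q.coeff 0‖ := by gcongr; exact hle m
        _ < ‖s‖ * ‖Q.coeff 0‖ := by gcongr
    have h2 : ‖s * Q.coeff (m + 1)‖ * r ^ (m + 1) < ‖s‖ * ‖Q.coeff 0‖ := by
      rw [norm_mul, mul_assoc]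
      exact mul_lt_mul_of_pos_left (hlt m.succ_ne_zero) (hr.trans hsr)
    have h3 := norm_sub_le_max (Q.coeff m) (s * Q.coeff (m + 1))
    rcases le_max_iff.mp h3 with h | h
    · exact (mul_le_mul_of_nonneg_right h (by positivity)).trans_lt h1
    · exact (mul_le_mul_of_nonneg_right h (by positivity)).trans_lt h2

/-- Over an ultrametric field, a polynomial strictly dominated by its constant coefficient on
the closed disk of radius `r` around `0` has no zeros there. -/
theorem eval_ne_zero_of_norm_coeff_mul_pow_lt {K : Type*} [NormedField K]
    [IsUltrametricDist K] {r : ℝ} (P : K[X])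
    (hP : ∀ n : ℕ, n ≠ 0 → ‖P.coeff n‖ * r ^ n < ‖P.coeff 0‖) {x : K} (hx : ‖x‖ ≤ r) :
    P.eval x ≠ 0 := by
  have hterm : ∀ n : ℕ, n ≠ 0 → ‖P.coeff n * x ^ n‖ < ‖P.coeff 0‖ := fun n hn => by
    rw [norm_mul, norm_pow]
    exact (by gcongr : ‖P.coeff n‖ * ‖x‖ ^ n ≤ ‖P.coeff n‖ * r ^ n).trans_lt (hP n hn)
  have hpos : 0 < ‖P.coeff 0‖ := (norm_nonneg _).trans_lt (hterm 1 one_ne_zero)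
  rw [eval_eq_sum_range, Finset.sum_range_succ']
  intro h
  have hsum : ‖∑ n ∈ Finset.range P.natDegree, P.coeff (n + 1) * x ^ (n + 1)‖ < ‖P.coeff 0‖ := by
    rcases (Finset.range P.natDegree).eq_empty_or_nonempty with he | hne
    · simpa [he] using hpos
    · obtain ⟨i, -, hi⟩ := IsUltrametricDist.exists_norm_finsetSum_le_of_nonempty hne
        (fun n => P.coeff (n + 1) * x ^ (n + 1))
      exact hi.trans_lt (hterm _ i.succ_ne_zero)
  rw [eq_neg_of_add_eq_zero_left h] at hsum
  simp at hsum

theorem finite_muFactor_set (p : ℕ) [Fact (Nat.Prime p)] (d : ℕ) :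
    {x : ℝ | ∃ l : ℕ, 2 ≤ l ∧ l ≤ d ∧
      x = ‖(l : ℚ_[p])‖ ^ ((1 : ℝ) / ((l : ℝ) - 1))}.Finite := by
  refine ((Set.finite_Icc 2 d).image
    fun l : ℕ => ‖(l : ℚ_[p])‖ ^ ((1 : ℝ) / ((l : ℝ) - 1))).subset ?_
  rintro x ⟨l, h2, hd, rfl⟩
  exact ⟨l, ⟨h2, hd⟩, rfl⟩

theorem muFactor_pos (p : ℕ) [Fact (Nat.Prime p)] {d : ℕ} (hd : 2 ≤ d) : 0 < muFactor p d := by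
  obtain ⟨l, h2, -, hl⟩ := Set.Nonempty.csInf_mem (by exact ⟨_, 2, le_rfl, hd, rfl⟩)
    (finite_muFactor_set p d)
  rw [muFactor, hl]
  have : (l : ℚ_[p]) ≠ 0 := Nat.cast_ne_zero.mpr (by omega)
  positivity

theorem muFactor_pow_le (p : ℕ) [Fact (Nat.Prime p)] {d n : ℕ} (hn : n ≠ 0) (hnd : n + 1 ≤ d) :
    muFactor p d ^ n ≤ ‖((n + 1 : ℕ) : ℚ_[p])‖ := by
  have h := csInf_le (finite_muFactor_set p d).bddBelow ⟨n + 1, by omega, hnd, rfl⟩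
  calc muFactor p d ^ n
      ≤ (‖((n + 1 : ℕ) : ℚ_[p])‖ ^ ((1 : ℝ) / (((n + 1 : ℕ) : ℝ) - 1))) ^ n :=
        pow_le_pow_left₀ (muFactor_pos p (by omega)).le h n
    _ = ‖((n + 1 : ℕ) : ℚ_[p])‖ := by
        rw [Nat.cast_add_one (R := ℝ), add_sub_cancel_right, one_div]
        exact Real.rpow_inv_natCast_pow (norm_nonneg _) hn

theorem muFactor_le_one (p : ℕ) [Fact (Nat.Prime p)] {d : ℕ} (hd : 2 ≤ d) : muFactor p d ≤ 1 := by
  have h := muFactor_pow_le p one_ne_zero hd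
  rw [pow_one] at h
  exact h.trans (by exact_mod_cast Padic.norm_int_le_one (p := p) (1 + 1 : ℕ))

/-- If the derivative of `g` has no zeros in the closed disk of radius `δ` around `a`, then on the
closed disk of radius `muFactor p d * δ` the value `g a` is taken at `a` only. -/
theorem eq_of_eval_eq_of_norm_sub_le_muFactor {p : ℕ} [Fact (Nat.Prime p)] {K : Type*}
    [NormedField K] [IsAlgClosed K] [IsUltrametricDist K] [Algebra ℚ_[p] K]
    (hext : ∀ q : ℚ_[p], ‖algebraMap ℚ_[p] K q‖ = ‖q‖) {d : ℕ} {g : K[X]}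
    (hdeg : g.natDegree ≤ d) {δ : ℝ} (hδ : 0 < δ) {a b : K}
    (hg : ∀ x ∈ Metric.closedBall a δ, (derivative g).eval x ≠ 0)
    (hab : ‖b - a‖ ≤ muFactor p d * δ) (h : g.eval b = g.eval a) : b = a := by
  have hder : ∀ n : ℕ, (taylor a (derivative g)).coeff n
      = (taylor a g).coeff (n + 1) * ((n + 1 : ℕ) : K) := fun n => by
    have hcomm : taylor a (derivative g) = derivative (taylor a g) := by
      simp [taylor_apply, derivative_comp]
    rw [hcomm, coeff_derivative, Nat.cast_add_one]
  have hne : ∀ x : K, ‖x‖ ≤ δ → (taylor a (derivative g)).eval x ≠ 0 := fun x hx => by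
    rw [taylor_eval]
    exact hg _ (by simpa [dist_eq_norm] using hx)
  have hcoeff : ∀ n : ℕ, n ≠ 0 → ‖(taylor a g).divX.coeff n‖ * (muFactor p d * δ) ^ n
      < ‖(taylor a g).divX.coeff 0‖ := fun n hn => by
    have key := norm_coeff_mul_pow_lt_of_eval_ne_zero hδ _ hne hn
    rw [hder, hder, norm_mul] at key
    simp only [coeff_divX]
    simp only [zero_add, Nat.cast_one, mul_one] at key ⊢
    rcases le_or_gt (n + 1) d with hnd | hnd
    · have hcast : ‖((n + 1 : ℕ) : K)‖ = ‖((n + 1 : ℕ) : ℚ_[p])‖ := by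
        rw [← hext, map_natCast]
      rw [hcast] at key
      refine lt_of_le_of_lt ?_ key
      rw [mul_pow, ← mul_assoc]
      gcongr
      exact muFactor_pow_le p hn hnd
    · rw [coeff_eq_zero_of_natDegree_lt (by rw [natDegree_taylor]; omega), norm_zero,
        zero_mul] at key ⊢
      simpa using key
  have hev := eval_ne_zero_of_norm_coeff_mul_pow_lt _ hcoeff hab
  have hsplit := congrArg (eval (b - a)) (divX_mul_X_add (taylor a g))
  rw [taylor_eval, sub_add_cancel, eval_add, eval_mul, eval_X, eval_C, taylor_coeff_zero, h,
    add_eq_right] at hsplit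
  exact sub_eq_zero.mp ((mul_eq_zero.mp hsplit).resolve_left hev)

/-- If `lam ≤ ‖g.derivative z‖` and `‖c - g z‖ ≤ ε`, then `c` has a preimage
under `g` at distance at most `ε / lam` from `z`. -/
theorem exists_eval_eq_of_norm_sub_le {K : Type*} [NormedField K] [IsAlgClosed K]
    [IsUltrametricDist K] (g : K[X]) (z c : K) {lam ε : ℝ} (hlam : 0 < lam) (hε : 0 < ε)
    (hder : lam ≤ ‖(derivative g).eval z‖) (hc : ‖c - g.eval z‖ ≤ ε) :
    ∃ w : K, g.eval w = c ∧ ‖w - z‖ ≤ ε / lam := by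
  by_contra! hno
  have hne : ∀ x : K, ‖x‖ ≤ ε / lam → (taylor z g - C c).eval x ≠ 0 := fun x hx h0 => by
    rw [eval_sub, taylor_eval, eval_C, sub_eq_zero] at h0
    have := hno _ h0
    rw [add_sub_cancel_right] at this
    exact hx.not_gt this
  have key := norm_coeff_mul_pow_lt_of_eval_ne_zero (div_pos hε hlam) _ hne one_ne_zero
  rw [coeff_sub, coeff_sub, coeff_C_zero, coeff_C_of_ne_zero one_ne_zero, sub_zero, pow_one,
    taylor_coeff_one, taylor_coeff_zero, norm_sub_rev] at key
  have h1 : lam * (ε / lam) ≤ ‖(derivative g).eval z‖ * (ε / lam) := by gcongr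
  rw [mul_div_cancel₀ _ hlam.ne'] at h1
  linarith

/-- **Proposition 3.8.** Under the standing assumptions on `B`, `M`, `δ`, `λ` and
`μ := min {|l|^{1/(l-1)} : 2 ≤ l ≤ d} · δ`, if `f` and `g` are both expanding on `B` with
backward-invariant `B` and `|f - g| ≤ μ` on `B`, then for every `z ∈ f⁻¹(B)` there is a
unique `w` with `g(w) = f(z)` and `|w - z| ≤ μ / λ`. -/
theorem unique_nearby_preimage_of_perturbed_map
    {p : ℕ} [Fact (Nat.Prime p)] {K : Type*} [NormedField K] [IsAlgClosed K]
    [CompleteSpace K] [IsUltrametricDist K] [Algebra ℚ_[p] K]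
    (hext : ∀ q : ℚ_[p], ‖algebraMap ℚ_[p] K q‖ = ‖q‖)
    (d : ℕ) (hd : 2 ≤ d)
    (B : Set K) (hB : B.Nonempty)
    (M : ℝ) (hM : 1 ≤ M) (hBM : B ⊆ Metric.closedBall 0 M)
    (δ : ℝ) (hδ : 0 < δ) (hδ1 : δ ≤ 1)
    (hthick : ∀ z ∈ B, Metric.closedBall z δ ⊆ B)
    (lam : ℝ) (hlam : 1 < lam)
    (f g : K[X]) (hdegf : f.natDegree = d) (hdegg : g.natDegree = d)
    (hexpf : ∀ z ∈ B, lam ≤ ‖(derivative f).eval z‖)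
    (hexpg : ∀ z ∈ B, lam ≤ ‖(derivative g).eval z‖)
    (hinvf : (fun z => f.eval z) ⁻¹' B ⊆ B)
    (hinvg : (fun z => g.eval z) ⁻¹' B ⊆ B)
    (hclose : ∀ z ∈ B, ‖f.eval z - g.eval z‖ ≤ muFactor p d * δ) :
    ∀ z : K, f.eval z ∈ B →
      ∃! w : K, g.eval w = f.eval z ∧ ‖w - z‖ ≤ muFactor p d * δ / lam := by
  intro z hz
  have hμ : 0 < muFactor p d * δ := mul_pos (muFactor_pos p hd) hδ
  have hlam0 : 0 < lam := one_pos.trans hlam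
  have hμle : muFactor p d * δ / lam ≤ muFactor p d * δ := div_le_self hμ.le hlam.le
  have hμδ : muFactor p d * δ ≤ δ := mul_le_of_le_one_left hδ.le (muFactor_le_one p hd)
  have hzB : z ∈ B := hinvf hz
  obtain ⟨w, hw, hwz⟩ := exists_eval_eq_of_norm_sub_le g z (f.eval z) hlam0 hμ (hexpg z hzB)
    (hclose z hzB)
  refine ⟨w, ⟨hw, hwz⟩, fun v ⟨hv, hvz⟩ => ?_⟩
  have hwB : w ∈ B := hinvg (by simpa [hw] using hz)
  refine eq_of_eval_eq_of_norm_sub_le_muFactor hext hdegg.le hδ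
    (fun x hx => norm_pos_iff.mp (hlam0.trans_le (hexpg x (hthick w hwB hx)))) ?_
    (hv.trans hw.symm)
  rw [← sub_sub_sub_cancel_right v w z]
  exact (norm_sub_le_max _ _).trans ((max_le hvz hwz).trans hμle)
end
end

section
/- Let f be a polynomial map of degree d ≥ 2 over ℂ_p with non-empty Julia set J(f). Suppose B ⊆ ℂ_p is non-empty and satisfies: there exists λ > 1 with |f'(z)| ≥ λ for all z ∈ B; f⁻¹(B) ⊆ B; B is bounded; and there exists δ > 0 with D̄_δ(z) ⊆ B for all z ∈ B. Then f has a repelling periodic point in B: there exist P ∈ B and m ∈ ℕ with m ≥ 1 such that f^m(P) = P and |(f^m)'(P)| ≥ λ^m > 1. -/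
open Polynomial

noncomputable section

variable {K : Type*}

open Filter Topology

section AlgClosed

variable {E : Type*} [NormedField E]

/-- The absolute values of an algebraically closed field with non-trivial absolute value are dense
in the positive reals. -/
lemma exists_norm_mem_Ioo_of_isAlgClosed [IsAlgClosed E] {c : E} (hc : 1 < ‖c‖) {a b : ℝ}
    (ha : 0 < a) (hab : a < b) : ∃ z : E, a < ‖z‖ ∧ ‖z‖ < b := by
  obtain ⟨n, hn⟩ := pow_unbounded_of_one_lt ‖c‖ ((one_lt_div ha).2 hab)
  have hn0 : n ≠ 0 := by
    rintro rfl
    simp only [pow_zero] at hn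
    linarith
  obtain ⟨q, hq⟩ := IsAlgClosed.exists_pow_nat_eq c (Nat.pos_of_ne_zero hn0)
  have hqn : ‖q‖ ^ n = ‖c‖ := by rw [← norm_pow, hq]
  have hq1 : 1 < ‖q‖ := by
    by_contra! h
    have := pow_le_one₀ (norm_nonneg q) h (n := n)
    linarith
  have hq2 : ‖q‖ < b / a := by
    rw [← hqn] at hn
    exact lt_of_pow_lt_pow_left₀ n (div_pos (ha.trans hab) ha).le hn
  obtain ⟨k, hk1, hk2⟩ := exists_mem_Ico_zpow ha hq1
  refine ⟨q ^ (k + 1), by rwa [norm_zpow], ?_⟩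
  have hq0 : (0 : ℝ) < ‖q‖ := by linarith
  rw [norm_zpow, zpow_add_one₀ hq0.ne']
  calc ‖q‖ ^ k * ‖q‖ ≤ a * ‖q‖ := by gcongr
    _ < a * (b / a) := by gcongr
    _ = b := by field_simp

lemma exists_norm_mem_Ioo_notMem [IsAlgClosed E] {c : E} (hc : 1 < ‖c‖) {a b : ℝ}
    (ha : 0 < a) (hab : a < b) {S : Set ℝ} (hS : S.Finite) :
    ∃ z : E, a < ‖z‖ ∧ ‖z‖ < b ∧ ‖z‖ ∉ S := by
  have hopen : IsOpen (Set.Ioo a b \ S) := isOpen_Ioo.sdiff hS.isClosed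
  obtain ⟨t, ht⟩ : (Set.Ioo a b \ S).Nonempty := ((Set.Ioo_infinite hab).sdiff hS).nonempty
  obtain ⟨ε, hε, hball⟩ := Metric.isOpen_iff.1 hopen t ht
  obtain ⟨z, hz1, hz2⟩ := exists_norm_mem_Ioo_of_isAlgClosed hc (ha.trans ht.1.1)
    (lt_add_of_pos_right t hε)
  have hz : ‖z‖ ∈ Set.Ioo a b \ S := hball <| by
    rw [Metric.mem_ball, Real.dist_eq, abs_lt]
    constructor <;> linarith
  exact ⟨z, hz.1.1, hz.1.2, hz.2⟩

lemma norm_eval_eq_prod_roots [IsAlgClosed E] (g : E[X]) (t : E) :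
    ‖g.eval t‖ = ‖g.leadingCoeff‖ * (g.roots.map fun a => ‖t - a‖).prod := by
  have h := map_multiset_prod (normHom : E →*₀ ℝ) (g.roots.map fun a => t - a)
  rw [(IsAlgClosed.splits g).eval_eq_prod_roots t, norm_mul]
  congr 1
  simpa [Multiset.map_map, Function.comp_def] using h

end AlgClosed

section Ultrametric

variable {E : Type*} [NormedField E] [IsUltrametricDist E]

lemma norm_sub_le_max_norm (a b : E) : ‖a - b‖ ≤ max ‖a‖ ‖b‖ := by
  have h := IsUltrametricDist.norm_add_le_max a (-b)
  rwa [← sub_eq_add_neg, norm_neg] at h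

lemma norm_sub_le_max_norm_sub (a b c : E) : ‖a - c‖ ≤ max ‖a - b‖ ‖b - c‖ := by
  have h := IsUltrametricDist.norm_add_le_max (a - b) (b - c)
  rwa [sub_add_sub_cancel] at h

lemma norm_sub_eq_of_norm_lt {a b : E} (h : ‖b‖ < ‖a‖) : ‖a - b‖ = ‖a‖ := by
  have h' := IsUltrametricDist.norm_add_eq_max_of_norm_ne_norm (x := a) (y := -b)
    (by rw [norm_neg]; exact h.ne')
  rw [← sub_eq_add_neg, norm_neg, max_eq_left h.le] at h'
  exact h'

/-- A polynomial whose absolute value is not constant on a disc has a zero in that disc. -/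
lemma Polynomial.exists_eval_eq_zero_of_norm_ne [IsAlgClosed E] {g : E[X]} {x w : E} {r : ℝ}
    (hw : ‖w - x‖ ≤ r) (hne : ‖g.eval w‖ ≠ ‖g.eval x‖) : ∃ z, ‖z - x‖ ≤ r ∧ g.eval z = 0 := by
  by_contra! hcon
  apply hne
  rw [norm_eval_eq_prod_roots, norm_eval_eq_prod_roots]
  congr 2
  refine Multiset.map_congr rfl fun a ha => ?_
  have hr : r < ‖a - x‖ := by
    by_contra! h
    exact hcon a h (isRoot_of_mem_roots ha)
  have h := norm_sub_eq_of_norm_lt (hw.trans_lt hr)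
  rw [show a - x - (w - x) = a - w by ring] at h
  rw [norm_sub_rev w, norm_sub_rev x, h]

/-- A non-archimedean Schwarz lemma: a polynomial bounded on a disc is Lipschitz near its centre,
with a constant depending only on the bound and the radius. -/
lemma Polynomial.norm_eval_sub_eval_le [IsAlgClosed E] {c : E} (hc : 1 < ‖c‖) {g : E[X]}
    {w : E} {r M : ℝ} (hr : 0 < r) (hM : ∀ z, ‖z - w‖ ≤ r → ‖g.eval z‖ ≤ M) {z : E}
    (hz : ‖z - w‖ ≤ r / 2) : ‖g.eval z - g.eval w‖ ≤ ‖z - w‖ * (M / (r / 2)) := by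
  obtain ⟨h, hh⟩ : X - C w ∣ g - C (g.eval w) := by
    rw [dvd_iff_isRoot]; simp
  have hev (t : E) : g.eval t - g.eval w = (t - w) * h.eval t := by
    simpa using congrArg (eval t) hh
  obtain ⟨u, hu1, hu2, hu3⟩ := exists_norm_mem_Ioo_notMem hc (half_pos hr) (half_lt_self hr)
    (S := (fun a => ‖w - a‖) '' {a | a ∈ h.roots})
    ((Multiset.finite_toSet h.roots).image _)
  have hle : ‖h.eval z‖ ≤ ‖h.eval (w + u)‖ := by
    rw [norm_eval_eq_prod_roots, norm_eval_eq_prod_roots]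
    refine mul_le_mul_of_nonneg_left ?_ (norm_nonneg _)
    refine Multiset.prod_map_le_prod_map₀ _ _ (fun _ _ => norm_nonneg _) fun a ha => ?_
    have hne : ‖u‖ ≠ ‖w - a‖ := fun h => hu3 ⟨a, ha, h.symm⟩
    have heq := IsUltrametricDist.norm_add_eq_max_of_norm_ne_norm hne
    rw [show w + u - a = u + (w - a) by ring, heq]
    exact (norm_sub_le_max_norm_sub z w a).trans (max_le_max (hz.trans hu1.le) le_rfl)
  have hbound : ‖u‖ * ‖h.eval (w + u)‖ ≤ M := by
    have h1 := hev (w + u)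
    rw [add_sub_cancel_left] at h1
    rw [← norm_mul, ← h1]
    refine (norm_sub_le_max_norm _ _).trans (max_le (hM _ ?_) (hM _ ?_))
    · rw [add_sub_cancel_left]; exact hu2.le
    · simpa using hr.le
  rw [hev, norm_mul]
  refine mul_le_mul_of_nonneg_left (hle.trans ?_) (norm_nonneg _)
  rw [le_div_iff₀ (half_pos hr)]
  calc ‖h.eval (w + u)‖ * (r / 2) ≤ ‖h.eval (w + u)‖ * ‖u‖ := by gcongr
    _ ≤ M := by rwa [mul_comm]

lemma exists_chordal_lt_imp (w : E) {η : ℝ} (hη : 0 < η) :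
    ∃ δ > 0, ∀ y : P1 E, chordal (toP1 w) y < δ → ∃ z, y = toP1 z ∧ ‖z - w‖ < η := by
  have hA : (0 : ℝ) < max ‖w‖ 1 := lt_max_of_lt_right one_pos
  have hA1 : 1 ≤ max ‖w‖ 1 := le_max_right _ _
  set A := max ‖w‖ 1 with hAdef
  refine ⟨min (1 / A) (η / A ^ 2), by positivity, fun y hy => ?_⟩
  obtain ⟨hy1, hy2⟩ := lt_min_iff.1 hy
  rcases y with _ | z
  · exact absurd hy1 (lt_irrefl (1 / A))
  · refine ⟨z, rfl, ?_⟩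
    change ‖w - z‖ / (A * max ‖z‖ 1) < _ at hy1 hy2
    have hzA : ‖z‖ ≤ A := by
      by_contra! h
      have hmax : max ‖z‖ 1 = ‖z‖ := max_eq_left (hA1.trans h.le)
      have hzpos : 0 < ‖z‖ := hA.trans h
      rw [hmax, norm_sub_rev, norm_sub_eq_of_norm_lt ((le_max_left _ _).trans_lt h),
        mul_comm, ← div_div, div_self hzpos.ne'] at hy1
      exact lt_irrefl _ hy1
    have hmax : max ‖z‖ 1 ≤ A := max_le hzA hA1
    have hzpos : (0 : ℝ) < max ‖z‖ 1 := lt_max_of_lt_right one_pos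
    rw [div_lt_iff₀ (by positivity)] at hy2
    rw [norm_sub_rev]
    calc ‖w - z‖ < η / A ^ 2 * (A * max ‖z‖ 1) := hy2
      _ ≤ η / A ^ 2 * (A * A) := by gcongr
      _ = η := by field_simp

end Ultrametric

section Chordal

variable {E : Type*} [NormedField E]

lemma chordal_toP1_le_norm_sub (z w : E) : chordal (toP1 z) (toP1 w) ≤ ‖z - w‖ := by
  change ‖z - w‖ / (max ‖z‖ 1 * max ‖w‖ 1) ≤ _
  refine div_le_self (norm_nonneg _) (one_le_mul_of_one_le_of_one_le ?_ ?_) <;>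
    exact le_max_right _ _

lemma chordal_toP1_le_of_le_norm [IsUltrametricDist E] {z w : E} {R : ℝ} (hR : 0 < R)
    (hz : R ≤ ‖z‖) (hw : R ≤ ‖w‖) : chordal (toP1 z) (toP1 w) ≤ 1 / R := by
  change ‖z - w‖ / (max ‖z‖ 1 * max ‖w‖ 1) ≤ _
  have h1 : (0 : ℝ) < max ‖z‖ 1 := lt_max_of_lt_right one_pos
  have h2 : (0 : ℝ) < max ‖w‖ 1 := lt_max_of_lt_right one_pos
  have hz' : R ≤ max ‖z‖ 1 := hz.trans (le_max_left _ _)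
  have hw' : R ≤ max ‖w‖ 1 := hw.trans (le_max_left _ _)
  rw [div_le_div_iff₀ (by positivity) hR, one_mul]
  have h := norm_sub_le_max_norm z w
  rcases le_max_iff.1 h with h | h
  · exact mul_le_mul (h.trans (le_max_left _ _)) hw' hR.le h1.le
  · rw [mul_comm (max ‖z‖ 1)]
    exact mul_le_mul (h.trans (le_max_left _ _)) hz' hR.le h2.le

lemma polyMap_iterate_toP1 (f : E[X]) (n : ℕ) (z : E) :
    (polyMap f)^[n] (toP1 z) = toP1 ((fun w => f.eval w)^[n] z) := by
  induction n generalizing z with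
  | zero => rfl
  | succ n ih => exact ih (f.eval z)

lemma polyMap_iterate_infty (f : E[X]) (n : ℕ) :
    (polyMap f)^[n] P1.infty = P1.infty := by
  induction n with
  | zero => rfl
  | succ n ih => exact ih

lemma continuous_iterate_eval (f : E[X]) (n : ℕ) :
    Continuous ((fun w => f.eval w)^[n]) :=
  Continuous.iterate f.continuous n

end Chordal

section Dynamics

variable {E : Type*} [NormedField E]

lemma Polynomial.exists_two_mul_norm_le_norm_eval (f : E[X]) (hf : 2 ≤ f.natDegree) :
    ∃ R : ℝ, ∀ z : E, R < ‖z‖ → 2 * ‖z‖ ≤ ‖f.eval z‖ := by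
  have hdeg : 0 < f.divX.degree := by
    rw [← natDegree_pos_iff_degree_pos, natDegree_divX_eq_natDegree_tsub_one]
    omega
  have h := f.divX.tendsto_norm_atTop hdeg
    (l := comap (fun z : E => ‖z‖) atTop) (z := id) tendsto_comap
  obtain ⟨s, hs, hsub⟩ := mem_comap.1 (h.eventually_ge_atTop 3)
  obtain ⟨R, hR⟩ := mem_atTop_sets.1 hs
  refine ⟨max R ‖f.coeff 0‖, fun z hz => ?_⟩
  obtain ⟨hz1, hz2⟩ := max_lt_iff.1 hz
  have h3 : 3 ≤ ‖f.divX.eval z‖ := hsub (hR _ hz1.le)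
  have hev : f.eval z = f.divX.eval z * z + f.coeff 0 := by
    conv_lhs => rw [← f.divX_mul_X_add]
    simp
  have h1 := norm_sub_le (f.eval z) (f.coeff 0)
  rw [hev, add_sub_cancel_right, norm_mul, ← hev] at h1
  nlinarith [norm_nonneg z]

lemma two_pow_mul_norm_le_norm_iterate {φ : E → E} {R : ℝ}
    (hR : ∀ z, R < ‖z‖ → 2 * ‖z‖ ≤ ‖φ z‖) {z : E} (hz : R < ‖z‖) (n : ℕ) :
    2 ^ n * ‖z‖ ≤ ‖φ^[n] z‖ := by
  induction n generalizing z with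
  | zero => simp
  | succ n ih =>
    have h := hR z hz
    have h1 := ih (z := φ z) (by linarith [norm_nonneg z])
    rw [Function.iterate_succ_apply, pow_succ, mul_assoc]
    exact (mul_le_mul_of_nonneg_left h (by positivity)).trans h1

variable [IsUltrametricDist E]

/-- Equicontinuity of the iterates at a finite point, in terms of the norm near that point. -/
lemma equicontinuous_at_toP1_of_norm {f : E[X]} {y : E}
    (h : ∀ ε > 0, ∃ η > 0, ∀ z : E, ‖z - y‖ < η → ∀ n : ℕ,
      chordal (toP1 ((fun w => f.eval w)^[n] y)) (toP1 ((fun w => f.eval w)^[n] z)) < ε) :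
    ∀ ε > 0, ∃ δ > 0, ∀ z : P1 E, chordal (toP1 y) z < δ →
      ∀ n : ℕ, chordal ((polyMap f)^[n] (toP1 y)) ((polyMap f)^[n] z) < ε := by
  intro ε hε
  obtain ⟨η, hη, hη'⟩ := h ε hε
  obtain ⟨δ, hδ, hδ'⟩ := exists_chordal_lt_imp y hη
  refine ⟨δ, hδ, fun z hz n => ?_⟩
  obtain ⟨z, rfl, hzy⟩ := hδ' z hz
  rw [polyMap_iterate_toP1, polyMap_iterate_toP1]
  exact hη' z hzy n

lemma isRhoOpen_toP1_image {U : Set E} (hU : IsOpen U) : IsRhoOpen (toP1 '' U) := by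
  rintro _ ⟨y, hy, rfl⟩
  obtain ⟨η, hη, hball⟩ := Metric.isOpen_iff.1 hU y hy
  obtain ⟨δ, hδ, hδ'⟩ := exists_chordal_lt_imp y hη
  refine ⟨δ, hδ, fun z hz => ?_⟩
  obtain ⟨z, rfl, hzy⟩ := hδ' z hz
  exact ⟨z, hball (by rwa [Metric.mem_ball, dist_eq_norm]), rfl⟩

lemma equicontinuous_at_of_escaping {f : E[X]} {R : ℝ} (hR1 : 1 ≤ R)
    (hR : ∀ z, R < ‖z‖ → 2 * ‖z‖ ≤ ‖f.eval z‖) {y : E} {N : ℕ}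
    (hy : R < ‖(fun w => f.eval w)^[N] y‖) :
    ∀ ε > 0, ∃ δ > 0, ∀ z : P1 E, chordal (toP1 y) z < δ →
      ∀ n : ℕ, chordal ((polyMap f)^[n] (toP1 y)) ((polyMap f)^[n] z) < ε := by
  refine equicontinuous_at_toP1_of_norm fun ε hε => ?_
  obtain ⟨k, hk⟩ := pow_unbounded_of_one_lt (1 / ε) (one_lt_two : (1 : ℝ) < 2)
  have hev : ∀ᶠ z in 𝓝 y, R < ‖(fun w => f.eval w)^[N] z‖ ∧
      ∀ n ∈ Finset.range (N + k),
        ‖(fun w => f.eval w)^[n] y - (fun w => f.eval w)^[n] z‖ < ε := by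
    refine ((continuous_iterate_eval f N).norm.continuousAt.eventually_const_lt hy).and ?_
    rw [eventually_all_finset]
    intro n _
    have hc : Continuous fun z =>
        ‖(fun w => f.eval w)^[n] y - (fun w => f.eval w)^[n] z‖ :=
      (continuous_const.sub (continuous_iterate_eval f n)).norm
    exact hc.continuousAt.eventually_lt_const (by simpa using hε)
  obtain ⟨η, hη, hball⟩ := Metric.eventually_nhds_iff.1 hev
  refine ⟨η, hη, fun z hz n => ?_⟩
  obtain ⟨hz1, hz2⟩ := hball (by rwa [dist_eq_norm])
  rcases lt_or_ge n (N + k) with hn | hn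
  · exact (chordal_toP1_le_norm_sub _ _).trans_lt (hz2 n (Finset.mem_range.2 hn))
  · obtain ⟨m, rfl⟩ := Nat.exists_eq_add_of_le hn
    have key {t : E} (ht : R < ‖(fun w => f.eval w)^[N] t‖) :
        2 ^ k ≤ ‖(fun w => f.eval w)^[N + k + m] t‖ := by
      have h := two_pow_mul_norm_le_norm_iterate hR ht (k + m)
      rw [← Function.iterate_add_apply, show k + m + N = N + k + m by ring] at h
      refine le_trans ?_ h
      have h2 : (2 : ℝ) ^ k ≤ 2 ^ (k + m) := pow_le_pow_right₀ one_le_two (Nat.le_add_right _ _)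
      nlinarith [pow_pos (two_pos : (0 : ℝ) < 2) k]
    refine (chordal_toP1_le_of_le_norm (by positivity) (key hy) (key hz1)).trans_lt ?_
    rw [div_lt_iff₀ hε] at hk
    rw [div_lt_iff₀ (by positivity)]
    linarith

lemma infty_mem_fatou {f : E[X]} {R : ℝ} (hR1 : 1 ≤ R)
    (hR : ∀ z, R < ‖z‖ → 2 * ‖z‖ ≤ ‖f.eval z‖) : P1.infty ∈ fatou f := by
  have near {s : ℝ} (hs : 1 ≤ s) {z : E}
      (hz : chordal P1.infty (toP1 z) < 1 / s) : s < ‖z‖ := by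
    have hz' : 1 / max ‖z‖ 1 < 1 / s := hz
    rw [one_div_lt_one_div (lt_max_of_lt_right one_pos) (by linarith)] at hz'
    exact (lt_max_iff.1 hz').resolve_right (by linarith)
  refine ⟨insert P1.infty (toP1 '' {z : E | R < ‖z‖}), Or.inl rfl, ?_, ?_⟩
  · rintro y (rfl | hy)
    · refine ⟨1 / R, by positivity, fun z hz => ?_⟩
      rcases z with _ | z
      · exact Or.inl rfl
      · exact Or.inr ⟨z, near hR1 hz, rfl⟩
    · obtain ⟨ε, hε, h⟩ := isRhoOpen_toP1_image (isOpen_lt continuous_const continuous_norm) y hy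
      exact ⟨ε, hε, fun z hz => Or.inr (h z hz)⟩
  · rintro y (rfl | ⟨y, hy, rfl⟩)
    · intro ε hε
      have hs : 1 ≤ max R (1 / ε) := hR1.trans (le_max_left _ _)
      refine ⟨1 / max R (1 / ε), by positivity, fun z hz n => ?_⟩
      rw [polyMap_iterate_infty]
      rcases z with _ | z
      · change chordal _ ((polyMap f)^[n] P1.infty) < ε
        rw [polyMap_iterate_infty]
        exact hε
      · change chordal _ ((polyMap f)^[n] (toP1 z)) < ε
        obtain ⟨hz1, hz2⟩ := max_lt_iff.1 (near hs hz)
        have h := two_pow_mul_norm_le_norm_iterate hR hz1 n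
        have h2 : (1 : ℝ) ≤ 2 ^ n := one_le_pow₀ one_le_two
        rw [polyMap_iterate_toP1]
        change 1 / max ‖(fun w => f.eval w)^[n] z‖ 1 < ε
        rw [one_div_lt (lt_max_of_lt_right one_pos) hε]
        refine lt_max_of_lt_left ?_
        nlinarith [norm_nonneg z]
    · exact equicontinuous_at_of_escaping hR1 hR (N := 0) hy

lemma toP1_mem_fatou_of_escaping {f : E[X]} {R : ℝ} (hR1 : 1 ≤ R)
    (hR : ∀ z, R < ‖z‖ → 2 * ‖z‖ ≤ ‖f.eval z‖) {x : E} {N : ℕ}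
    (hx : R < ‖(fun w => f.eval w)^[N] x‖) : toP1 x ∈ fatou f := by
  refine ⟨toP1 '' {z : E | R < ‖(fun w => f.eval w)^[N] z‖}, ⟨x, hx, rfl⟩,
    isRhoOpen_toP1_image (isOpen_lt continuous_const (continuous_iterate_eval f N).norm), ?_⟩
  rintro _ ⟨y, hy, rfl⟩
  exact equicontinuous_at_of_escaping hR1 hR hy

/-- A disc on which all iterates are uniformly bounded lies in the Fatou set. -/
lemma toP1_mem_fatou_of_bounded [IsAlgClosed E] {c : E} (hc : 1 < ‖c‖) {f : E[X]} {R r : ℝ}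
    (hR : 0 < R) (hr : 0 < r) {x : E}
    (hx : ∀ w, ‖w - x‖ ≤ r → ∀ n : ℕ, ‖(fun w => f.eval w)^[n] w‖ ≤ R) : toP1 x ∈ fatou f := by
  refine ⟨toP1 '' Metric.ball x r, ⟨x, Metric.mem_ball_self hr, rfl⟩,
    isRhoOpen_toP1_image Metric.isOpen_ball, ?_⟩
  rintro _ ⟨y, hy, rfl⟩
  rw [Metric.mem_ball, dist_eq_norm] at hy
  refine equicontinuous_at_toP1_of_norm fun ε hε => ?_
  refine ⟨min (r / 2) (ε / (R / (r / 2))), by positivity, fun z hz n => ?_⟩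
  obtain ⟨hz1, hz2⟩ := lt_min_iff.1 hz
  have hev (t : E) : (fun w => f.eval w)^[n] t = (f.comp^[n] X).eval t := by
    rw [iterate_comp_eval, eval_X]
  refine (chordal_toP1_le_norm_sub _ _).trans_lt ?_
  rw [norm_sub_rev, hev, hev]
  refine (norm_eval_sub_eval_le hc hr (M := R) (fun w hw => ?_) hz1.le).trans_lt
    ((lt_div_iff₀ (by positivity)).1 hz2)
  rw [← hev]
  exact hx w ((norm_sub_le_max_norm_sub w y x).trans (max_le hw hy.le)) n

end Dynamics

/-- A finite backward orbit which starts in a backward-invariant set stays in it. -/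
lemma mem_of_iterate_mem {α : Type*} {φ : α → α} {B : Set α} (hinv : φ ⁻¹' B ⊆ B) {n : ℕ} {z : α}
    (h : φ^[n] z ∈ B) : z ∈ B := by
  induction n generalizing z with
  | zero => exact h
  | succ n ih => exact hinv (ih h)

lemma pow_le_norm_eval_derivative_iterate_comp {E : Type*} [NormedField E] {f : E[X]} {lam : ℝ}
    (hlam : 0 ≤ lam) {z : E} {m : ℕ}
    (h : ∀ i < m, lam ≤ ‖(derivative f).eval ((fun w => f.eval w)^[i] z)‖) :
    lam ^ m ≤ ‖(derivative (f.comp^[m] X)).eval z‖ := by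
  induction m with
  | zero => simp
  | succ m ih =>
    have h1 := ih fun i hi => h i (hi.trans m.lt_succ_self)
    rw [Function.iterate_succ_apply', derivative_comp, eval_mul, eval_comp, iterate_comp_eval,
      eval_X, norm_mul, pow_succ]
    exact mul_le_mul h1 (h m m.lt_succ_self) hlam (norm_nonneg _)

/-- **Lemma 3.9.** If `f` has non-empty Julia set and admits a non-empty bounded thick
backward-invariant set `B` on which it is expanding with constant `λ > 1`, then `f` has a
repelling periodic point `P` in `B`: `f^m(P) = P` and `|(f^m)'(P)| ≥ λ^m > 1`. -/
theorem exists_repelling_periodic_point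
    {p : ℕ} [Fact (Nat.Prime p)] {K : Type*} [NormedField K] [IsAlgClosed K]
    [CompleteSpace K] [IsUltrametricDist K] [Algebra ℚ_[p] K]
    (hext : ∀ q : ℚ_[p], ‖algebraMap ℚ_[p] K q‖ = ‖q‖)
    (d : ℕ) (hd : 2 ≤ d) (f : K[X]) (hdeg : f.natDegree = d)
    (hJ : (julia f).Nonempty)
    (B : Set K) (hB : B.Nonempty)
    (lam : ℝ) (hlam : 1 < lam)
    (hexp : ∀ z ∈ B, lam ≤ ‖(derivative f).eval z‖)
    (hinv : (fun z => f.eval z) ⁻¹' B ⊆ B)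
    (hbdd : ∃ M : ℝ, 0 < M ∧ B ⊆ Metric.closedBall 0 M)
    (hthick : ∃ δ : ℝ, 0 < δ ∧ ∀ z ∈ B, Metric.closedBall z δ ⊆ B) :
    ∃ P ∈ B, ∃ m : ℕ, 1 ≤ m ∧
      ((fun q : K[X] => f.comp q)^[m] X).eval P = P ∧
      lam ^ m ≤ ‖(derivative ((fun q : K[X] => f.comp q)^[m] X)).eval P‖ ∧
      (1 : ℝ) < lam ^ m := by
  obtain ⟨c, hc⟩ : ∃ c : K, 1 < ‖c‖ := by
    obtain ⟨q, hq⟩ := NormedField.exists_one_lt_norm ℚ_[p]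
    exact ⟨algebraMap ℚ_[p] K q, by rwa [hext]⟩
  obtain ⟨M, -, hM⟩ := hbdd
  obtain ⟨δ, hδ, hthick⟩ := hthick
  obtain ⟨y, hy⟩ := hB
  obtain ⟨R₀, hR₀⟩ := f.exists_two_mul_norm_le_norm_eval (hd.trans_eq hdeg.symm)
  obtain ⟨R, hR1, hRM, hR⟩ : ∃ R : ℝ, 1 ≤ R ∧ M ≤ R ∧
      ∀ z, R < ‖z‖ → 2 * ‖z‖ ≤ ‖f.eval z‖ :=
    ⟨max 1 (max M R₀), le_max_left _ _, (le_max_left _ _).trans (le_max_right _ _),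
      fun z hz => hR₀ z (((le_max_right _ _).trans (le_max_right _ _)).trans_lt hz)⟩
  have hRpos : 0 < R := by linarith
  obtain ⟨x, hx⟩ := hJ
  rcases x with _ | x
  · exact absurd (infty_mem_fatou hR1 hR) hx
  change toP1 x ∉ fatou f at hx
  have hxR (n : ℕ) : ‖(fun w => f.eval w)^[n] x‖ ≤ R := by
    by_contra! h
    exact hx (toP1_mem_fatou_of_escaping hR1 hR h)
  set r := min δ R with hrdef
  have hr : 0 < r := lt_min hδ hRpos
  obtain ⟨w, hw, n, hn⟩ : ∃ w, ‖w - x‖ ≤ r ∧ ∃ n : ℕ, R < ‖(fun w => f.eval w)^[n] w‖ := by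
    by_contra! h
    exact hx (toP1_mem_fatou_of_bounded hc hRpos hr h)
  have hx0 : ‖x‖ ≤ R := hxR 0
  have hwR : ‖w‖ ≤ R := by
    have h := IsUltrametricDist.norm_add_le_max (w - x) x
    rw [sub_add_cancel] at h
    exact h.trans (max_le (hw.trans (min_le_right _ _)) hx0)
  have hn1 : 1 ≤ n := by
    rcases Nat.eq_zero_or_pos n with rfl | h
    · exact absurd hwR hn.not_ge
    · exact h
  have hev (t : K) : (f.comp^[n] X).eval t = (fun w => f.eval w)^[n] t := by
    rw [iterate_comp_eval, eval_X]
  have hyR : ‖y‖ ≤ R := by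
    have h := hM hy
    rw [mem_closedBall_zero_iff] at h
    exact h.trans hRM
  obtain ⟨u, hu, hu0⟩ := exists_eval_eq_zero_of_norm_ne (g := f.comp^[n] X - C y) hw (by
    rw [eval_sub, eval_sub, eval_C, eval_C, hev, hev,
      norm_sub_eq_of_norm_lt (hyR.trans_lt hn)]
    exact (((norm_sub_le_max_norm _ _).trans (max_le (hxR n) hyR)).trans_lt hn).ne')
  obtain ⟨P, hP, hP0⟩ := exists_eval_eq_zero_of_norm_ne (g := f.comp^[n] X - X) hw (by
    rw [eval_sub, eval_sub, eval_X, eval_X, hev, hev,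
      norm_sub_eq_of_norm_lt (hwR.trans_lt hn)]
    exact (((norm_sub_le_max_norm _ _).trans (max_le (hxR n) hx0)).trans_lt hn).ne')
  rw [eval_sub, eval_C, hev, sub_eq_zero] at hu0
  rw [eval_sub, eval_X, hev, sub_eq_zero] at hP0
  have huB : u ∈ B := mem_of_iterate_mem hinv (n := n) (by rwa [hu0])
  have hPB : P ∈ B := by
    refine hthick u huB ?_
    rw [Metric.mem_closedBall, dist_eq_norm]
    refine (norm_sub_le_max_norm_sub P x u).trans (max_le (hP.trans (min_le_left _ _)) ?_)
    rw [norm_sub_rev]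
    exact hu.trans (min_le_left _ _)
  refine ⟨P, hPB, n, hn1, (hev P).trans hP0,
    pow_le_norm_eval_derivative_iterate_comp (by linarith) fun i hi => hexp _ ?_,
    one_lt_pow₀ hlam (by omega)⟩
  refine mem_of_iterate_mem hinv (n := n - i) ?_
  rwa [← Function.iterate_add_apply, Nat.sub_add_cancel hi.le, hP0]
end
end

section
/- Let p be a prime number and d ≥ 2 a natural number not divisible by p, let c ∈ ℂ_p with |c| > 1, and let f_c(z) := z^d + c. Then the Julia set J(f_c) is non-empty, J(f_c) ⊆ {z ∈ ℂ_p : |z| = |c|^{1/d}}, and |f_c'(z)| = |c|^{(d−1)/d} > 1 for every z with |z| = |c|^{1/d}; in particular, f_c is immediately expanding (J(f_c) ≠ ∅ and there exists λ > 1 with |f_c'(z)| ≥ λ for all z ∈ J(f_c)). -/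
open Polynomial

noncomputable section

variable {K : Type*}

theorem P1.cases_toP1 (x : P1 K) : x = P1.infty ∨ ∃ z : K, x = toP1 z := by
  rcases x with _ | z
  · exact Or.inl rfl
  · exact Or.inr ⟨z, rfl⟩

theorem polyMap_toP1 [CommRing K] (f : K[X]) (z : K) :
    polyMap f (toP1 z) = toP1 (f.eval z) := rfl

theorem eval_X_pow_add_C [CommRing K] (m : ℕ) (c z : K) :
    (X ^ m + C c : K[X]).eval z = z ^ m + c := by
  simp

theorem norm_eval_derivative [NormedField K] {n : ℕ} {c z : K} (hnK : ‖((n + 1 : ℕ) : K)‖ = 1) :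
    ‖(derivative (X ^ (n + 1) + C c : K[X])).eval z‖ = ‖z‖ ^ n := by
  have e : (derivative (X ^ (n + 1) + C c : K[X])).eval z = ((n + 1 : ℕ) : K) * z ^ n := by
    simp
  rw [e, norm_mul, hnK, norm_pow, one_mul]

section NormedField

variable [NormedField K]

/-- The points of the projective line of absolute value larger than `R`, including `∞`. -/
def outerDisc (R : ℝ) : Set (P1 K) := {x | ∀ z : K, x = toP1 z → R < ‖z‖}

/-- The points of the affine line of absolute value smaller than `R`. -/
def innerDisc (R : ℝ) : Set (P1 K) := {x | ∃ z : K, x = toP1 z ∧ ‖z‖ < R}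

theorem toP1_mem_outerDisc {R : ℝ} {z : K} : toP1 z ∈ outerDisc R ↔ R < ‖z‖ := by
  constructor
  · intro h
    exact h z rfl
  · intro h w hw
    cases hw
    exact h

theorem infty_mem_outerDisc {R : ℝ} : (P1.infty : P1 K) ∈ outerDisc R := by
  intro w hw
  cases hw

theorem toP1_mem_innerDisc {R : ℝ} {z : K} : toP1 z ∈ innerDisc R ↔ ‖z‖ < R := by
  constructor
  · rintro ⟨w, hw, h⟩
    cases hw
    exact h
  · intro h
    exact ⟨z, rfl, h⟩

theorem chordal_toP1 (z w : K) :
    chordal (toP1 z) (toP1 w) = ‖z - w‖ / (max ‖z‖ 1 * max ‖w‖ 1) := rfl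

theorem chordal_infty_right (w : K) : chordal (toP1 w) P1.infty = 1 / max ‖w‖ 1 := rfl

theorem chordal_comm (x y : P1 K) : chordal x y = chordal y x := by
  rcases P1.cases_toP1 x with rfl | ⟨z, rfl⟩ <;> rcases P1.cases_toP1 y with rfl | ⟨w, rfl⟩
  · rfl
  · rfl
  · rfl
  · rw [chordal_toP1, chordal_toP1, norm_sub_rev, mul_comm (max ‖z‖ 1)]

/-- A pointwise criterion for membership in the Fatou set: `S` is at distance at least `r` from its
complement, `f` maps `S` into `T` and `T` into itself, and `f` increases distances neither on `S`
nor on `T`. -/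
theorem mem_fatou_of_chordal_le {f : K[X]} {S T : Set (P1 K)} {r : ℝ} (hr : 0 < r)
    (hS : ∀ x ∈ S, ∀ y ∉ S, r ≤ chordal x y)
    (hST : ∀ x ∈ S, polyMap f x ∈ T) (hTT : ∀ x ∈ T, polyMap f x ∈ T)
    (hSle : ∀ x ∈ S, ∀ y ∈ S, chordal (polyMap f x) (polyMap f y) ≤ chordal x y)
    (hTle : ∀ x ∈ T, ∀ y ∈ T, chordal (polyMap f x) (polyMap f y) ≤ chordal x y)
    {x : P1 K} (hx : x ∈ S) : x ∈ fatou f := by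
  have hopen : ∀ x ∈ S, ∀ y, chordal x y < r → y ∈ S := fun x hx y hxy => by
    by_contra hy
    exact (hS x hx y hy).not_gt hxy
  have hTn : ∀ n : ℕ, ∀ x ∈ T, ∀ y ∈ T,
      chordal ((polyMap f)^[n] x) ((polyMap f)^[n] y) ≤ chordal x y := by
    intro n
    induction n with
    | zero => intro x _ y _; exact le_rfl
    | succ n ih =>
      intro x hx y hy
      rw [Function.iterate_succ_apply, Function.iterate_succ_apply]
      exact (ih _ (hTT x hx) _ (hTT y hy)).trans (hTle x hx y hy)
  have hSn : ∀ n : ℕ, ∀ x ∈ S, ∀ y ∈ S,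
      chordal ((polyMap f)^[n] x) ((polyMap f)^[n] y) ≤ chordal x y := by
    intro n x hx y hy
    cases n with
    | zero => exact le_rfl
    | succ n =>
      rw [Function.iterate_succ_apply, Function.iterate_succ_apply]
      exact (hTn n _ (hST x hx) _ (hST y hy)).trans (hSle x hx y hy)
  refine ⟨S, hx, fun x hx => ⟨r, hr, hopen x hx⟩, fun y hy ε hε => ⟨min ε r, lt_min hε hr, ?_⟩⟩
  intro z hz n
  exact (hSn n y hy z (hopen y hy z (hz.trans_le (min_le_right _ _)))).trans_lt
    (hz.trans_le (min_le_left _ _))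

end NormedField

section Ultrametric

variable [NormedField K] [IsUltrametricDist K]

theorem norm_sub_eq_right_of_lt {z w : K} (h : ‖z‖ < ‖w‖) : ‖z - w‖ = ‖w‖ := by
  rw [norm_sub_rev, sub_eq_add_neg,
    IsUltrametricDist.norm_add_eq_max_of_norm_ne_norm (by rw [norm_neg]; exact h.ne'),
    norm_neg, max_eq_left h.le]

theorem norm_pow_succ_sub_pow_succ_le {y z : K} {m : ℝ} (hy : ‖y‖ ≤ m) (hz : ‖z‖ ≤ m) (n : ℕ) :
    ‖y ^ (n + 1) - z ^ (n + 1)‖ ≤ ‖y - z‖ * m ^ n := by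
  have hm : 0 ≤ m := (norm_nonneg y).trans hy
  induction n with
  | zero => simp
  | succ n ih =>
    have e : y ^ (n + 1 + 1) - z ^ (n + 1 + 1)
        = y * (y ^ (n + 1) - z ^ (n + 1)) + (y - z) * z ^ (n + 1) := by ring
    rw [e]
    refine (IsUltrametricDist.norm_add_le_max _ _).trans (max_le ?_ ?_)
    · rw [norm_mul]
      calc ‖y‖ * ‖y ^ (n + 1) - z ^ (n + 1)‖ ≤ m * (‖y - z‖ * m ^ n) := by gcongr
        _ = ‖y - z‖ * m ^ (n + 1) := by ring
    · rw [norm_mul, norm_pow]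
      gcongr

/-- First-order Taylor estimate for powers, with the factor `R` moved to the left-hand side. -/
theorem mul_norm_pow_succ_taylor_le {w z : K} {R : ℝ} (hR : 0 ≤ R) (hw : ‖w‖ ≤ R) (hz : ‖z‖ ≤ R)
    (n : ℕ) :
    R * ‖w ^ (n + 1) - z ^ (n + 1) - (n + 1 : ℕ) * z ^ n * (w - z)‖ ≤ ‖w - z‖ ^ 2 * R ^ n := by
  induction n with
  | zero => simp
  | succ n ih =>
    have e : w ^ (n + 1 + 1) - z ^ (n + 1 + 1) - ((n + 1 + 1 : ℕ) : K) * z ^ (n + 1) * (w - z)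
        = w * (w ^ (n + 1) - z ^ (n + 1) - ((n + 1 : ℕ) : K) * z ^ n * (w - z))
          + ((n + 1 : ℕ) : K) * z ^ n * (w - z) ^ 2 := by
      push_cast; ring
    rw [e]
    refine (mul_le_mul_of_nonneg_left (IsUltrametricDist.norm_add_le_max _ _) hR).trans ?_
    rw [mul_max_of_nonneg _ _ hR]
    refine max_le ?_ ?_
    · rw [norm_mul]
      calc _ = ‖w‖ * (R * ‖w ^ (n + 1) - z ^ (n + 1) - ((n + 1 : ℕ) : K) * z ^ n * (w - z)‖) := by
            ring
        _ ≤ R * (‖w - z‖ ^ 2 * R ^ n) := by gcongr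
        _ = _ := by ring
    · rw [norm_mul, norm_mul, norm_pow, norm_pow]
      have h1 : ‖((n + 1 : ℕ) : K)‖ ≤ 1 := IsUltrametricDist.norm_natCast_le_one K _
      calc R * (‖((n + 1 : ℕ) : K)‖ * ‖z‖ ^ n * ‖w - z‖ ^ 2)
          ≤ R * (1 * R ^ n * ‖w - z‖ ^ 2) := by gcongr
        _ = _ := by ring

/-- If the exponent is a unit, the power map scales distances exactly on small discs. -/
theorem norm_pow_succ_sub_pow_succ_eq {w z : K} {R : ℝ} {n : ℕ} (hR : 0 < R)
    (hn : ‖((n + 1 : ℕ) : K)‖ = 1) (hw : ‖w‖ = R) (hz : ‖z‖ = R) (h : ‖w - z‖ < R) :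
    ‖w ^ (n + 1) - z ^ (n + 1)‖ = R ^ n * ‖w - z‖ := by
  rcases eq_or_ne w z with rfl | hne
  · simp
  have hpos : 0 < ‖w - z‖ := norm_pos_iff.2 (sub_ne_zero.2 hne)
  have hlin : ‖((n + 1 : ℕ) : K) * z ^ n * (w - z)‖ = R ^ n * ‖w - z‖ := by
    rw [norm_mul, norm_mul, norm_pow, hn, hz, one_mul]
  have ht := mul_norm_pow_succ_taylor_le hR.le hw.le hz.le n
  have hlt : ‖w ^ (n + 1) - z ^ (n + 1) - ((n + 1 : ℕ) : K) * z ^ n * (w - z)‖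
      < ‖((n + 1 : ℕ) : K) * z ^ n * (w - z)‖ := by
    rw [hlin]
    refine lt_of_mul_lt_mul_left (ht.trans_lt ?_) hR.le
    have : 0 < ‖w - z‖ * R ^ n := by positivity
    nlinarith
  have e := IsUltrametricDist.norm_add_eq_max_of_norm_ne_norm hlt.ne
  rw [sub_add_cancel, max_eq_right hlt.le, hlin] at e
  exact e

theorem chordal_of_norm_lt {z w : K} (h : ‖z‖ < ‖w‖) (hw : 1 ≤ ‖w‖) :
    chordal (toP1 z) (toP1 w) = 1 / max ‖z‖ 1 := by
  have : 0 < ‖w‖ := by linarith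
  rw [chordal_toP1, norm_sub_eq_right_of_lt h, max_eq_left hw]
  field_simp

theorem one_div_le_chordal_innerDisc {R : ℝ} (hR : 1 ≤ R) {x y : P1 K} (hx : x ∈ innerDisc R)
    (hy : y ∉ innerDisc R) : 1 / R ≤ chordal x y := by
  obtain ⟨z, rfl, hz⟩ := hx
  have key : 1 / R ≤ 1 / max ‖z‖ 1 := by
    apply one_div_le_one_div_of_le (by positivity) (max_le hz.le hR)
  rcases P1.cases_toP1 y with rfl | ⟨w, rfl⟩
  · exact key
  · rw [toP1_mem_innerDisc, not_lt] at hy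
    rwa [chordal_of_norm_lt (hz.trans_le hy) (hR.trans hy)]

theorem one_div_le_chordal_outerDisc {R : ℝ} (hR : 1 ≤ R) {x y : P1 K} (hx : x ∈ outerDisc R)
    (hy : y ∉ outerDisc R) : 1 / R ≤ chordal x y := by
  rcases P1.cases_toP1 y with rfl | ⟨w, rfl⟩
  · exact absurd infty_mem_outerDisc hy
  rw [toP1_mem_outerDisc, not_lt] at hy
  have key : 1 / R ≤ 1 / max ‖w‖ 1 := by
    apply one_div_le_one_div_of_le (by positivity) (max_le hy hR)
  rcases P1.cases_toP1 x with rfl | ⟨z, rfl⟩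
  · exact key
  · rw [toP1_mem_outerDisc] at hx
    rwa [chordal_comm, chordal_of_norm_lt (hy.trans_lt hx) (hR.trans hx.le)]

end Ultrametric

section Unicritical

variable [NormedField K] [IsUltrametricDist K] {c : K} {R : ℝ} {n : ℕ}

theorem norm_eval_of_lt (hRc : R ^ (n + 1) = ‖c‖) {z : K} (hz : ‖z‖ < R) :
    ‖(X ^ (n + 1) + C c : K[X]).eval z‖ = R ^ (n + 1) := by
  have h : ‖z ^ (n + 1)‖ < ‖c‖ := by
    rw [norm_pow, ← hRc]
    exact pow_lt_pow_left₀ hz (norm_nonneg _) (by omega)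
  rw [eval_X_pow_add_C, IsUltrametricDist.norm_add_eq_max_of_norm_ne_norm h.ne,
    max_eq_right h.le, hRc]

theorem norm_eval_of_gt (hR : 0 ≤ R) (hRc : R ^ (n + 1) = ‖c‖) {z : K} (hz : R < ‖z‖) :
    ‖(X ^ (n + 1) + C c : K[X]).eval z‖ = ‖z‖ ^ (n + 1) := by
  have h : ‖c‖ < ‖z ^ (n + 1)‖ := by
    rw [norm_pow, ← hRc]
    exact pow_lt_pow_left₀ hz hR (by omega)
  rw [eval_X_pow_add_C, IsUltrametricDist.norm_add_eq_max_of_norm_ne_norm h.ne',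
    max_eq_left h.le, norm_pow]

theorem polyMap_mem_outerDisc_of_innerDisc (hR : 1 < R) (hn : 1 ≤ n) (hRc : R ^ (n + 1) = ‖c‖)
    (x : P1 K) (hx : x ∈ innerDisc R) : polyMap (X ^ (n + 1) + C c) x ∈ outerDisc R := by
  obtain ⟨z, rfl, hz⟩ := hx
  rw [polyMap_toP1, toP1_mem_outerDisc, norm_eval_of_lt hRc hz]
  exact lt_self_pow₀ hR (by omega)

theorem polyMap_mem_outerDisc (hR : 1 < R) (hn : 1 ≤ n) (hRc : R ^ (n + 1) = ‖c‖)
    (x : P1 K) (hx : x ∈ outerDisc R) : polyMap (X ^ (n + 1) + C c) x ∈ outerDisc R := by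
  rcases P1.cases_toP1 x with rfl | ⟨z, rfl⟩
  · exact infty_mem_outerDisc
  rw [toP1_mem_outerDisc] at hx
  rw [polyMap_toP1, toP1_mem_outerDisc, norm_eval_of_gt (by linarith) hRc hx]
  exact hx.trans (lt_self_pow₀ (hR.trans hx) (by omega))

theorem chordal_polyMap_le_of_innerDisc (hR : 1 < R) (hn : 1 ≤ n) (hRc : R ^ (n + 1) = ‖c‖)
    (x : P1 K) (hx : x ∈ innerDisc R) (y : P1 K) (hy : y ∈ innerDisc R) :
    chordal (polyMap (X ^ (n + 1) + C c) x) (polyMap (X ^ (n + 1) + C c) y) ≤ chordal x y := by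
  obtain ⟨z, rfl, hz⟩ := hx
  obtain ⟨w, rfl, hw⟩ := hy
  have hR0 : 0 < R := by linarith
  have hR1 : 1 ≤ R ^ (n + 1) := one_le_pow₀ hR.le
  have hsub : (X ^ (n + 1) + C c : K[X]).eval z - (X ^ (n + 1) + C c : K[X]).eval w
      = z ^ (n + 1) - w ^ (n + 1) := by
    rw [eval_X_pow_add_C, eval_X_pow_add_C]; ring
  rw [polyMap_toP1, polyMap_toP1, chordal_toP1, chordal_toP1, norm_eval_of_lt hRc hz,
    norm_eval_of_lt hRc hw, max_eq_left hR1, hsub]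
  calc ‖z ^ (n + 1) - w ^ (n + 1)‖ / (R ^ (n + 1) * R ^ (n + 1))
      ≤ ‖z - w‖ * R ^ n / (R ^ (n + 1) * R ^ (n + 1)) := by
        gcongr
        exact norm_pow_succ_sub_pow_succ_le hz.le hw.le n
    _ = ‖z - w‖ / (R ^ (n + 1) * R) := by
        field_simp
        ring
    _ ≤ ‖z - w‖ / (R * R) := by
        gcongr
        exact le_self_pow₀ hR.le (by omega)
    _ ≤ _ := by
        gcongr
        · exact max_le hz.le hR.le
        · exact max_le hw.le hR.le

theorem chordal_polyMap_le_of_outerDisc (hR : 1 < R) (hRc : R ^ (n + 1) = ‖c‖)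
    (x : P1 K) (hx : x ∈ outerDisc R) (y : P1 K) (hy : y ∈ outerDisc R) :
    chordal (polyMap (X ^ (n + 1) + C c) x) (polyMap (X ^ (n + 1) + C c) y) ≤ chordal x y := by
  have hR0 : 0 ≤ R := by linarith
  have hinf : ∀ z : K, R < ‖z‖ →
      1 / max ‖(X ^ (n + 1) + C c : K[X]).eval z‖ 1 ≤ 1 / max ‖z‖ 1 := by
    intro z hz
    have hz1 : 1 ≤ ‖z‖ := (hR.trans hz).le
    rw [norm_eval_of_gt hR0 hRc hz]
    gcongr
    exact le_self_pow₀ hz1 (by omega)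
  rcases P1.cases_toP1 x with rfl | ⟨z, rfl⟩ <;> rcases P1.cases_toP1 y with rfl | ⟨w, rfl⟩
  · exact le_rfl
  · exact hinf w (toP1_mem_outerDisc.1 hy)
  · exact hinf z (toP1_mem_outerDisc.1 hx)
  rw [toP1_mem_outerDisc] at hx hy
  have hz1 : 1 < ‖z‖ := hR.trans hx
  have hw1 : 1 < ‖w‖ := hR.trans hy
  have hz0 : 0 < ‖z‖ := by linarith
  have hw0 : 0 < ‖w‖ := by linarith
  have hsub : (X ^ (n + 1) + C c : K[X]).eval z - (X ^ (n + 1) + C c : K[X]).eval w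
      = z ^ (n + 1) - w ^ (n + 1) := by
    rw [eval_X_pow_add_C, eval_X_pow_add_C]; ring
  rw [polyMap_toP1, polyMap_toP1, chordal_toP1, chordal_toP1, norm_eval_of_gt hR0 hRc hx,
    norm_eval_of_gt hR0 hRc hy, max_eq_left (one_le_pow₀ hz1.le), max_eq_left (one_le_pow₀ hw1.le),
    max_eq_left hz1.le, max_eq_left hw1.le, hsub]
  have hzw : ‖z‖ ≤ ‖z‖ * ‖w‖ := le_mul_of_one_le_right hz0.le hw1.le
  have hwz : ‖w‖ ≤ ‖z‖ * ‖w‖ := le_mul_of_one_le_left hw0.le hz1.le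
  calc ‖z ^ (n + 1) - w ^ (n + 1)‖ / (‖z‖ ^ (n + 1) * ‖w‖ ^ (n + 1))
      ≤ ‖z - w‖ * (‖z‖ * ‖w‖) ^ n / (‖z‖ ^ (n + 1) * ‖w‖ ^ (n + 1)) := by
        gcongr
        exact norm_pow_succ_sub_pow_succ_le hzw hwz n
    _ = ‖z - w‖ / (‖z‖ * ‖w‖) := by
        rw [mul_pow]
        field_simp
        ring

theorem innerDisc_subset_fatou (hR : 1 < R) (hn : 1 ≤ n) (hRc : R ^ (n + 1) = ‖c‖) :
    innerDisc R ⊆ fatou (X ^ (n + 1) + C c) := fun _ hx =>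
  mem_fatou_of_chordal_le (r := 1 / R) (by positivity)
    (fun _ h _ h' => one_div_le_chordal_innerDisc hR.le h h')
    (polyMap_mem_outerDisc_of_innerDisc hR hn hRc) (polyMap_mem_outerDisc hR hn hRc)
    (chordal_polyMap_le_of_innerDisc hR hn hRc) (chordal_polyMap_le_of_outerDisc hR hRc) hx

theorem outerDisc_subset_fatou (hR : 1 < R) (hn : 1 ≤ n) (hRc : R ^ (n + 1) = ‖c‖) :
    outerDisc R ⊆ fatou (X ^ (n + 1) + C c) := fun _ hx =>
  mem_fatou_of_chordal_le (r := 1 / R) (by positivity)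
    (fun _ h _ h' => one_div_le_chordal_outerDisc hR.le h h')
    (polyMap_mem_outerDisc hR hn hRc) (polyMap_mem_outerDisc hR hn hRc)
    (chordal_polyMap_le_of_outerDisc hR hRc) (chordal_polyMap_le_of_outerDisc hR hRc) hx

theorem exists_norm_eq_of_mem_julia (hR : 1 < R) (hn : 1 ≤ n) (hRc : R ^ (n + 1) = ‖c‖)
    {x : P1 K} (hx : x ∈ julia (X ^ (n + 1) + C c)) : ∃ z : K, x = toP1 z ∧ ‖z‖ = R := by
  rcases P1.cases_toP1 x with rfl | ⟨z, rfl⟩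
  · exact absurd (outerDisc_subset_fatou hR hn hRc infty_mem_outerDisc) hx
  refine ⟨z, rfl, ?_⟩
  rcases lt_trichotomy ‖z‖ R with h | h | h
  · exact absurd (innerDisc_subset_fatou hR hn hRc (toP1_mem_innerDisc.2 h)) hx
  · exact h
  · exact absurd (outerDisc_subset_fatou hR hn hRc (toP1_mem_outerDisc.2 h)) hx

theorem exists_fixedPoint_norm_eq [IsAlgClosed K] (hR : 1 < R) (hn : 1 ≤ n)
    (hRc : R ^ (n + 1) = ‖c‖) :
    ∃ z : K, (X ^ (n + 1) + C c : K[X]).eval z = z ∧ ‖z‖ = R := by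
  have hdeg : (X ^ (n + 1) - (X - C c) : K[X]).degree ≠ 0 := by
    rw [degree_sub_eq_left_of_degree_lt]
    · rw [degree_X_pow]
      exact_mod_cast Nat.succ_ne_zero n
    · rw [degree_X_pow, degree_X_sub_C]
      exact_mod_cast (by omega : 1 < n + 1)
  obtain ⟨z, hz⟩ := IsAlgClosed.exists_root _ hdeg
  have hfix : (X ^ (n + 1) + C c : K[X]).eval z = z := by
    have h0 : z ^ (n + 1) - (z - c) = 0 := by simpa [IsRoot.def] using hz
    rw [eval_X_pow_add_C]
    linear_combination h0
  refine ⟨z, hfix, ?_⟩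
  rcases lt_trichotomy ‖z‖ R with h | h | h
  · have h1 := norm_eval_of_lt (n := n) hRc h
    rw [hfix] at h1
    have h2 : R < R ^ (n + 1) := lt_self_pow₀ hR (by omega)
    linarith
  · exact h
  · have h1 := norm_eval_of_gt (n := n) (by linarith) hRc h
    rw [hfix] at h1
    have h2 : ‖z‖ < ‖z‖ ^ (n + 1) := lt_self_pow₀ (hR.trans h) (by omega)
    linarith

/-- Chordal balls of radius `1 / R` around points of the circle of radius `R` are contained in
open discs of radius `R`. -/
theorem exists_norm_sub_lt_of_chordal_lt (hR : 1 < R) {z : K} (hz : ‖z‖ = R) {y : P1 K}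
    (h : chordal (toP1 z) y < 1 / R) : ∃ w : K, y = toP1 w ∧ ‖w‖ = R ∧ ‖w - z‖ < R := by
  have hR0 : 0 < R := by linarith
  have hmax : max ‖z‖ 1 = R := by rw [hz, max_eq_left hR.le]
  rcases P1.cases_toP1 y with rfl | ⟨w, rfl⟩
  · rw [chordal_infty_right, hmax] at h
    exact absurd h (lt_irrefl _)
  have hw : ‖w‖ = R := by
    by_contra hne
    rcases lt_or_gt_of_ne hne with hlt | hgt
    · refine (one_div_le_chordal_innerDisc hR.le (toP1_mem_innerDisc.2 hlt)
        (y := toP1 z) ?_).not_gt (by rwa [chordal_comm])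
      rw [toP1_mem_innerDisc, hz]
      exact lt_irrefl _
    · refine (one_div_le_chordal_outerDisc hR.le (toP1_mem_outerDisc.2 hgt)
        (y := toP1 z) ?_).not_gt (by rwa [chordal_comm])
      rw [toP1_mem_outerDisc, hz]
      exact lt_irrefl _
  refine ⟨w, rfl, hw, ?_⟩
  rw [chordal_toP1, hmax, hw, max_eq_left hR.le, div_lt_div_iff₀ (by positivity) hR0, norm_sub_rev]
    at h
  nlinarith

theorem fixedPoint_mem_julia (hR : 1 < R) (hn : 1 ≤ n) (hnK : ‖((n + 1 : ℕ) : K)‖ = 1)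
    (hsmall : ∀ δ > 0, ∃ t : K, t ≠ 0 ∧ ‖t‖ < δ) {z : K}
    (hfix : (X ^ (n + 1) + C c : K[X]).eval z = z) (hz : ‖z‖ = R) :
    toP1 z ∈ julia (X ^ (n + 1) + C c) := by
  have hR0 : 0 < R := by linarith
  rintro ⟨U, hzU, -, hU⟩
  obtain ⟨δ, hδ, h⟩ := hU _ hzU (1 / R) (by positivity)
  obtain ⟨t, ht0, ht⟩ := hsmall δ hδ
  have hnear : chordal (toP1 z) (toP1 (z + t)) < δ := by
    rw [chordal_toP1, sub_add_cancel_left, norm_neg]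
    refine (div_le_self (norm_nonneg t) ?_).trans_lt ht
    exact one_le_mul_of_one_le_of_one_le (le_max_right _ _) (le_max_right _ _)
  have hfixn : ∀ k : ℕ, (polyMap (X ^ (n + 1) + C c))^[k] (toP1 z) = toP1 z := fun k =>
    Function.iterate_fixed (by rw [polyMap_toP1, hfix]) k
  have horb : ∀ k : ℕ, ∃ w : K, (polyMap (X ^ (n + 1) + C c))^[k] (toP1 (z + t)) = toP1 w ∧
      ‖w‖ = R ∧ ‖w - z‖ < R := fun k => by
    have hk := h _ hnear k
    rw [hfixn] at hk
    exact exists_norm_sub_lt_of_chordal_lt hR hz hk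
  have hgrow : ∀ k : ℕ, ∃ w : K, (polyMap (X ^ (n + 1) + C c))^[k] (toP1 (z + t)) = toP1 w ∧
      ‖w - z‖ = (R ^ n) ^ k * ‖t‖ := by
    intro k
    induction k with
    | zero => exact ⟨z + t, rfl, by simp⟩
    | succ k ih =>
      obtain ⟨w, hw, hwt⟩ := ih
      obtain ⟨w', hw', hwR, hwz⟩ := horb k
      obtain rfl : w = w' := Option.some.inj (hw.symm.trans hw')
      refine ⟨(X ^ (n + 1) + C c : K[X]).eval w, ?_, ?_⟩
      · rw [Function.iterate_succ_apply', hw, polyMap_toP1]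
      · have e : (X ^ (n + 1) + C c : K[X]).eval w - z = w ^ (n + 1) - z ^ (n + 1) := by
          rw [eval_X_pow_add_C] at hfix ⊢
          linear_combination hfix
        rw [e, norm_pow_succ_sub_pow_succ_eq hR0 hnK hwR hz hwz, hwt]
        ring
  have ht' : 0 < ‖t‖ := norm_pos_iff.2 ht0
  obtain ⟨k, hk⟩ := pow_unbounded_of_one_lt (R / ‖t‖) (one_lt_pow₀ hR (by omega : n ≠ 0))
  obtain ⟨w, hw, hwt⟩ := hgrow k
  obtain ⟨w', hw', -, hwz⟩ := horb k
  obtain rfl : w = w' := Option.some.inj (hw.symm.trans hw')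
  rw [div_lt_iff₀ ht'] at hk
  linarith

end Unicritical

theorem norm_natCast_eq_one_of_not_dvd {p : ℕ} [Fact (Nat.Prime p)] [NormedField K]
    [Algebra ℚ_[p] K] (hext : ∀ q : ℚ_[p], ‖algebraMap ℚ_[p] K q‖ = ‖q‖) {m : ℕ}
    (hm : ¬ p ∣ m) : ‖(m : K)‖ = 1 := by
  rw [← map_natCast (algebraMap ℚ_[p] K), hext, Padic.norm_natCast_eq_one_iff]
  exact (Nat.Prime.coprime_iff_not_dvd Fact.out).2 hm

theorem exists_ne_zero_norm_lt {p : ℕ} [Fact (Nat.Prime p)] [NormedField K]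
    [Algebra ℚ_[p] K] (hext : ∀ q : ℚ_[p], ‖algebraMap ℚ_[p] K q‖ = ‖q‖) {δ : ℝ} (hδ : 0 < δ) :
    ∃ t : K, t ≠ 0 ∧ ‖t‖ < δ := by
  obtain ⟨q, hq0, hq⟩ := NormedField.exists_norm_lt ℚ_[p] hδ
  refine ⟨algebraMap ℚ_[p] K q, ?_, by rwa [hext]⟩
  rw [← norm_pos_iff, hext]
  exact hq0

/-- **Lemma 3.10.** For `p ∤ d`, `d ≥ 2` and `|c| > 1`, the Julia set of `f_c(z) = z^d + c`
is non-empty and contained in the circle `{|z| = |c|^{1/d}}`, on which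
`|f_c'(z)| = |c|^{(d-1)/d} > 1`; in particular `f_c` is immediately expanding. -/
theorem julia_in_circle_and_immediately_expanding
    {p : ℕ} [Fact (Nat.Prime p)] {K : Type*} [NormedField K] [IsAlgClosed K]
    [CompleteSpace K] [IsUltrametricDist K] [Algebra ℚ_[p] K]
    (hext : ∀ q : ℚ_[p], ‖algebraMap ℚ_[p] K q‖ = ‖q‖)
    (d : ℕ) (hd : 2 ≤ d) (hpd : ¬ (p ∣ d)) (c : K) (hc : 1 < ‖c‖) :
    (julia (X ^ d + C c)).Nonempty ∧
    (∀ x ∈ julia (X ^ d + C c), ∃ z : K, x = toP1 z ∧ ‖z‖ = ‖c‖ ^ ((1 : ℝ) / (d : ℝ))) ∧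
    (∀ z : K, ‖z‖ = ‖c‖ ^ ((1 : ℝ) / (d : ℝ)) →
      ‖(derivative (X ^ d + C c)).eval z‖ = ‖c‖ ^ (((d : ℝ) - 1) / (d : ℝ)) ∧
      1 < ‖c‖ ^ (((d : ℝ) - 1) / (d : ℝ))) ∧
    (∃ lam : ℝ, 1 < lam ∧ ∀ z : K, toP1 z ∈ julia (X ^ d + C c) →
      lam ≤ ‖(derivative (X ^ d + C c)).eval z‖) := by
  obtain ⟨n, rfl⟩ : ∃ n, d = n + 1 := ⟨d - 1, by omega⟩
  have hn : 1 ≤ n := by omega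
  set R : ℝ := ‖c‖ ^ ((1 : ℝ) / ((n + 1 : ℕ) : ℝ)) with hRdef
  have hR : 1 < R := Real.one_lt_rpow hc (by positivity)
  have hRc : R ^ (n + 1) = ‖c‖ := by
    rw [hRdef, one_div, Real.rpow_inv_natCast_pow (norm_nonneg c) (by omega)]
  have hRn : ‖c‖ ^ ((((n + 1 : ℕ) : ℝ) - 1) / ((n + 1 : ℕ) : ℝ)) = R ^ n := by
    rw [hRdef, ← Real.rpow_mul_natCast (norm_nonneg c)]
    congr 1
    push_cast
    ring
  have hnK : ‖((n + 1 : ℕ) : K)‖ = 1 := norm_natCast_eq_one_of_not_dvd hext hpd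
  have hlam : 1 < R ^ n := one_lt_pow₀ hR (by omega)
  rw [hRn]
  refine ⟨?_, fun x hx => exists_norm_eq_of_mem_julia hR hn hRc hx, fun z hz => ⟨?_, hlam⟩,
    R ^ n, hlam, fun z hz => ?_⟩
  · obtain ⟨z, hfix, hz⟩ := exists_fixedPoint_norm_eq hR hn hRc
    exact ⟨toP1 z, fixedPoint_mem_julia hR hn hnK (fun δ hδ => exists_ne_zero_norm_lt hext hδ)
      hfix hz⟩
  · rw [norm_eval_derivative hnK, hz]
  · obtain ⟨w, hw, hwR⟩ := exists_norm_eq_of_mem_julia hR hn hRc hz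
    obtain rfl : z = w := Option.some.inj hw
    rw [norm_eval_derivative hnK, hwR]
end
end
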